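/- Let K be a complete discretely valued field with residue field k of characteristic ≠ 2 such that u(k) < ∞. If i is any integer with 1 ≤ i ≤ u(k), then m_{i,1}(K) = min over 1 ≤ r ≤ i of (m_{r,1}(k) + m_{i−r+1,1}(k)). -/

import Mathlib

/-!  Diagonal quadratic forms over a field of characteristic ≠ 2.
In characteristic ≠ 2 every regular quadratic form is isometric to a diagonal form
`⟨d 1, …, d n⟩`, so we model (regular) quadratic forms by their diagonal
coefficient functions. -/

/-- The diagonal quadratic form `⟨d i⟩_{i : ι}` over `k`. -/
noncomputable def diagQF (k : Type) [Field k] {ι : Type} [Fintype ι] (d : ι → k) :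
    QuadraticForm k (ι → k) :=
  QuadraticMap.weightedSumSquares k d

/-- Isometry of (diagonal) quadratic forms. -/
def FormIsom (k : Type) [Field k] {ι κ : Type} [Fintype ι] [Fintype κ]
    (d : ι → k) (e : κ → k) : Prop :=
  QuadraticMap.Equivalent (diagQF k d) (diagQF k e)

/-- The orthogonal sum of `m` copies of the hyperbolic plane `⟨1, -1⟩`. -/
def hypForm (k : Type) [Field k] (m : ℕ) : Fin (2 * m) → k :=
  fun j => if j.val % 2 = 0 then 1 else -1

/-- The Witt index of a (diagonal) form: the largest `m` such that the form is isometric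
to `m·ℍ ⟂ (rest)` for some diagonal form `rest`. -/
noncomputable def wittIndex (k : Type) [Field k] {ι : Type} [Fintype ι] (d : ι → k) : ℕ :=
  sSup {m : ℕ | ∃ (s : ℕ) (e : Fin s → k), FormIsom k d (Sum.elim (hypForm k m) e)}
/-- The u-invariant of a field: the supremum of the dimensions of anisotropic regular
quadratic forms over `k` (`⊤` if unbounded). -/
noncomputable def uInv (k : Type) [Field k] : ℕ∞ :=
  sSup {N : ℕ∞ | ∃ n : ℕ, N = n ∧
    ∃ d : Fin n → k, (∀ t, d t ≠ 0) ∧ (diagQF k d).Anisotropic}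

/-- The refined m-invariant `m_{i,j}(k)`: the least dimension (`⊤` if there is none) of a
regular quadratic form `q` of dimension ≥ 1 over `k` with `i_W(q) < j` such that
`i_W(q ⟂ σ) ≥ j` for every `i`-dimensional regular form `σ` over `k`. -/
noncomputable def mInv (k : Type) [Field k] (i j : ℕ) : ℕ∞ :=
  sInf {N : ℕ∞ | ∃ n : ℕ, N = n ∧ 1 ≤ n ∧
    ∃ d : Fin n → k, (∀ t, d t ≠ 0) ∧ wittIndex k d < j ∧
      ∀ σ : Fin i → k, (∀ t, σ t ≠ 0) → j ≤ wittIndex k (Sum.elim d σ)}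
/-- The value group of (normalized) discrete valuations. -/
abbrev Zm0 : Type := WithZero (Multiplicative ℤ)

/-- The residue field of (the valuation ring of) a discrete valuation on a field. -/
noncomputable abbrev resField (K : Type) [Field K] (v : Valuation K Zm0) : Type :=
  IsLocalRing.ResidueField ↥v.valuationSubring

section hensel
open Filter Topology

lemma comp_seq (K : Type) [Field K] (v : Valuation K Zm0)
    (hcomp : @CompleteSpace K (Valued.mk' v).toUniformSpace) (s : ℕ → K) (c : Zm0) (hc : c < 1)
    (hs : ∀ n, v (s (n+1) - s n) ≤ c ^ (n+1)) :
    ∃ y, ∀ x : K, x ≠ 0 → ∃ N, ∀ n ≥ N, v (s n - y) < v x := by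
  let : Valued K Zm0 := Valued.mk' v
  have : CompleteSpace K := hcomp
  have key : ∀ n m, n ≤ m → v (s m - s n) ≤ c ^ (n+1) := by
    intro n m h
    induction m, h using Nat.le_induction with
    | base => simp
    | succ m hm ih =>
      have : s (m+1) - s n = (s (m+1) - s m) + (s m - s n) := by ring
      rw [this]
      refine (v.map_add _ _).trans (max_le ((hs m).trans ?_) ih)
      exact pow_le_pow_right_of_le_one' hc.le (by omega)
  have hcau : Cauchy (map s atTop) := by
    rw [Valued.cauchy_iff]
    refine ⟨inferInstance, fun γ => ?_⟩
    obtain ⟨n, hn⟩ := exists_pow_lt₀ hc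
      (Units.map (MonoidWithZeroHom.ValueGroup₀.embedding (f := (.ofClass v))) γ)
    refine ⟨s '' Set.Ici n, image_mem_map (Ici_mem_atTop n), ?_⟩
    rintro _ ⟨a, ha, rfl⟩ _ ⟨b, hb, rfl⟩
    rw [Valuation.restrict_lt_iff_lt_embedding]
    refine lt_of_le_of_lt ?_ hn
    change v (s b - s a) ≤ _
    rcases le_total a b with h | h
    · exact (key a b h).trans (pow_le_pow_right_of_le_one' hc.le (by simp at ha; omega))
    · rw [Valuation.map_sub_swap]
      exact (key b a h).trans (pow_le_pow_right_of_le_one' hc.le (by simp at hb; omega))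
  obtain ⟨y, hy⟩ := CompleteSpace.complete hcau
  refine ⟨y, fun x hx => ?_⟩
  have hx' : v.restrict x ≠ 0 := by simp [hx]
  have hmem : {z | v.restrict (z - y) < v.restrict x} ∈ 𝓝 y :=
    Valued.mem_nhds.2 ⟨Units.mk0 _ hx', fun z hz => hz⟩
  have := hy hmem
  rw [mem_map, mem_atTop_sets] at this
  obtain ⟨N, hN⟩ := this
  exact ⟨N, fun n hn => v.restrict_lt_iff.mp (hN n hn)⟩

lemma sqrt_one (K : Type) [Field K] (v : Valuation K Zm0)
    (hcomp : @CompleteSpace K (Valued.mk' v).toUniformSpace)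
    (h2 : v 2 = 1) (a : K) (ha : v (a - 1) < 1) : ∃ y, y ^ 2 = a := by
  have h20 : (2 : K) ≠ 0 := by intro h; simp [h] at h2
  set c := v (a - 1) with hcdef
  let s : ℕ → K := fun n => Nat.rec 1 (fun _ y => y - (y ^ 2 - a) / 2) n
  have s0 : s 0 = 1 := rfl
  have s1 : ∀ n, s (n+1) = s n - (s n ^ 2 - a) / 2 := fun n => rfl
  have inv : ∀ n, v (s n - 1) ≤ c ∧ v (s n ^ 2 - a) ≤ c ^ (n+1) := by
    intro n
    induction n with
    | zero => simp [s0, hcdef, Valuation.map_sub_swap]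
    | succ n ih =>
      obtain ⟨i1, i2⟩ := ih
      have i3 : v (s n ^ 2 - a) ≤ c := i2.trans (by
        simpa using pow_le_pow_right_of_le_one' ha.le (show 1 ≤ n+1 by omega))
      constructor
      · have : s (n+1) - 1 = (s n - 1) - (s n ^ 2 - a) / 2 := by rw [s1]; ring
        rw [this]
        refine (v.map_sub _ _).trans (max_le i1 ?_)
        simpa [h2] using i3
      · have : s (n+1) ^ 2 - a = (s n ^ 2 - a) * ((s n ^ 2 - a) / 2 ^ 2 - (s n - 1)) := by
          rw [s1]; field_simp; ring
        rw [this, map_mul, pow_succ c (n+1)]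
        refine mul_le_mul' i2 ((v.map_sub _ _).trans (max_le ?_ i1))
        simpa [h2] using i3
  obtain ⟨y, hy⟩ := comp_seq K v hcomp s c ha (fun n => by
    have : s (n+1) - s n = - ((s n ^ 2 - a) / 2) := by rw [s1]; ring
    rw [this, Valuation.map_neg]
    simpa [h2] using (inv n).2)
  refine ⟨y, ?_⟩
  by_contra hne
  have hne' : y ^ 2 - a ≠ 0 := sub_ne_zero.2 hne
  obtain ⟨N1, h1⟩ := hy _ hne'
  obtain ⟨N2, hN2⟩ := hy 1 one_ne_zero
  obtain ⟨N3, hN3⟩ := exists_pow_lt₀ ha (Units.mk0 _ (v.ne_zero_iff.2 hne'))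
  let n := max N1 (max N2 N3)
  have e1 := h1 n (by simp [n])
  have e2 := hN2 n (by simp [n])
  rw [map_one] at e2
  have e4 : v (s n) ≤ 1 := by
    have : s n = (s n - 1) + 1 := by ring
    rw [this]
    exact (v.map_add _ _).trans (max_le ((inv n).1.trans ha.le) (by simp))
  have e5 : v (y + s n) ≤ 1 := by
    have : y + s n = (2 * s n) - (s n - y) := by ring
    rw [this]
    exact (v.map_sub _ _).trans (max_le (by simpa [h2] using e4) e2.le)
  have e6 : v (s n ^ 2 - a) < v (y ^ 2 - a) :=
    ((inv n).2.trans (pow_le_pow_right_of_le_one' ha.le (by simp [n]; omega))).trans_lt hN3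
  have e7 : v ((s n - y) * (y + s n)) < v (y ^ 2 - a) := by
    rw [map_mul]
    exact (mul_le_of_le_one_right' e5).trans_lt e1
  have : y ^ 2 - a = (s n ^ 2 - a) - (s n - y) * (y + s n) := by ring
  have e8 := v.map_sub (s n ^ 2 - a) ((s n - y) * (y + s n))
  rw [← this] at e8
  exact absurd e8 (not_le.2 (max_lt e6 e7))
end hensel
section witt

/-- elementary anisotropy of a diagonal form -/
def QAn (k : Type) [Field k] {ι : Type} [Fintype ι] (d : ι → k) : Prop :=
  ∀ x : ι → k, ∑ t, d t * (x t) ^ 2 = 0 → x = 0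

lemma diagQF_apply (k : Type) [Field k] {ι : Type} [Fintype ι] (d x : ι → k) :
    diagQF k d x = ∑ t, d t * (x t) ^ 2 := by
  simp [diagQF, QuadraticMap.weightedSumSquares_apply, pow_two]

lemma anis_iff (k : Type) [Field k] {ι : Type} [Fintype ι] (d : ι → k) :
    (diagQF k d).Anisotropic ↔ QAn k d := by
  simp only [QuadraticMap.Anisotropic, QAn, diagQF_apply]

lemma qan_of_isom (k : Type) [Field k] {ι κ : Type} [Fintype ι] [Fintype κ]
    (d : ι → k) (e : κ → k) (h : FormIsom k d e) (hd : QAn k d) : QAn k e := by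
  obtain ⟨f⟩ := h
  intro x hx
  rw [← diagQF_apply] at hx
  have h1 : diagQF k d (f.symm x) = 0 := by
    rw [← hx]; exact f.symm.map_app x
  rw [diagQF_apply] at h1
  have h2 := hd _ h1
  exact f.symm.toLinearEquiv.map_eq_zero_iff.1 h2

lemma hyp_not_qan (k : Type) [Field k] (m s : ℕ) (hm : 1 ≤ m) (e : Fin s → k) :
    ¬ QAn k (Sum.elim (hypForm k m) e) := by
  intro h
  let a : Fin (2 * m) := ⟨0, by omega⟩
  let b : Fin (2 * m) := ⟨1, by omega⟩
  have hab : a ≠ b := by simp [a, b]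
  have := h (Sum.elim (fun t => if t = a ∨ t = b then 1 else 0) 0) (by
    rw [Fintype.sum_sum_type]
    simp only [Sum.elim_inl, Sum.elim_inr]
    rw [Finset.sum_eq_add a b hab]
    · simp [hypForm, a, b]
    · rintro c - ⟨h1, h2⟩
      simp [h1, h2]
    · simp
    · simp)
  have := congrFun this (Sum.inl a)
  simp at this

lemma isom_card (k : Type) [Field k] {ι κ : Type} [Fintype ι] [Fintype κ]
    (d : ι → k) (e : κ → k) (h : FormIsom k d e) : Fintype.card ι = Fintype.card κ := by
  obtain ⟨f⟩ := h
  simpa using f.toLinearEquiv.finrank_eq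

lemma hyp_basis (k : Type) [Field k] (h2 : (2 : k) ≠ 0) {V : Type} [AddCommGroup V] [Module k V]
    [FiniteDimensional k V] (B : LinearMap.BilinForm k V) (hsymm : ∀ y z, B y z = B z y)
    (e f : V) (hee : B e e = 1) (hff : B f f = -1) (hef : B e f = 0) :
    ∃ (s : ℕ) (b : Module.Basis (Fin (2 * 1) ⊕ Fin s) k V), B.IsOrthoᵢ b ∧
      b (Sum.inl 0) = e ∧ b (Sum.inl 1) = f := by
  let : Invertible (2 : k) := invertibleOfNonzero h2
  have hfe : B f e = 0 := by rw [hsymm, hef]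
  let W : Submodule k (V) := LinearMap.ker (B e) ⊓ LinearMap.ker (B f)
  have hW : ∀ w : W, B e w = 0 ∧ B f w = 0 := fun w => ⟨w.2.1, w.2.2⟩
  obtain ⟨v, hv⟩ := LinearMap.BilinForm.exists_orthogonal_basis (K := k) (V := W)
    (B := B.restrict W) ⟨fun a b => hsymm _ _⟩
  let P : (V) →ₗ[k] (V) := LinearMap.id - (B e).smulRight e + (B f).smulRight f
  have hP : ∀ z, P z = z - B e z • e + B f z • f := fun z => by simp [P]
  have hPW : ∀ z, P z ∈ W := by
    intro z
    refine ⟨?_, ?_⟩ <;> (change B _ (P z) = 0; rw [hP]) <;> simp [hee, hef, hfe, hff]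
  let E : (V) ≃ₗ[k] (Fin (2 * 1) → k) × W :=
    { toFun := fun z => (![B e z, - B f z], ⟨P z, hPW z⟩)
      map_add' := by
        intro a b
        ext t
        · fin_cases t
          · exact map_add (B e) a b
          · change -(B f (a + b)) = -(B f a) + -(B f b)
            rw [map_add]; ring
        · exact map_add P a b
      map_smul' := by
        intro a b
        ext t
        · fin_cases t
          · exact map_smul (B e) a b
          · change -(B f (a • b)) = a * -(B f b)
            rw [map_smul, smul_eq_mul]; ring
        · exact map_smul P a b
      invFun := fun p => p.1 0 • e + p.1 1 • f + p.2
      left_inv := by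
        intro z
        simp [hP]
        abel
      right_inv := by
        rintro ⟨p, w⟩
        obtain ⟨w1, w2⟩ := hW w
        ext t
        · fin_cases t <;> simp [hee, hef, hfe, hff, w1, w2]
        · simp [hP, hee, hef, hfe, hff, w1, w2]
          abel }
  let b : Module.Basis (Fin (2 * 1) ⊕ Fin (Module.finrank k W)) k (V) :=
    ((Pi.basisFun k (Fin (2 * 1))).prod v).map E.symm
  have hb0 : b (Sum.inl 0) = e := by
    simp [b, E]
  have hb1 : b (Sum.inl 1) = f := by
    simp [b, E]
  have hbr : ∀ t, b (Sum.inr t) = v t := by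
    intro t
    simp [b, E]
  have hortho : B.IsOrthoᵢ b := by
    intro s t hst
    change B (b s) (b t) = 0
    rcases s with s | s <;> rcases t with t | t
    · fin_cases s <;> fin_cases t
      · simp at hst
      · change B (b (Sum.inl 0)) (b (Sum.inl 1)) = 0
        rw [hb0, hb1, hef]
      · change B (b (Sum.inl 1)) (b (Sum.inl 0)) = 0
        rw [hb0, hb1, hfe]
      · simp at hst
    · rw [hbr]
      fin_cases s
      · change B (b (Sum.inl 0)) _ = 0
        rw [hb0, (hW _).1]
      · change B (b (Sum.inl 1)) _ = 0
        rw [hb1, (hW _).2]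
    · rw [hbr, hsymm]
      fin_cases t
      · change B (b (Sum.inl 0)) _ = 0
        rw [hb0, (hW _).1]
      · change B (b (Sum.inl 1)) _ = 0
        rw [hb1, (hW _).2]
    · rw [hbr, hbr]
      exact hv (fun h => hst (by rw [h]))
  exact ⟨_, b, hortho, hb0, hb1⟩

open QuadraticMap in
lemma isom_hyp (k : Type) [Field k] (h2 : (2 : k) ≠ 0) {ι : Type} [Fintype ι] (d : ι → k)
    (hd : ∀ t, d t ≠ 0) (hiso : ¬ QAn k d) :
    ∃ (s : ℕ) (e : Fin s → k), FormIsom k d (Sum.elim (hypForm k 1) e) := by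
  classical
  let : Invertible (2 : k) := invertibleOfNonzero h2
  unfold QAn at hiso
  push Not at hiso
  obtain ⟨x, hx0, hxne⟩ := hiso
  set Q := diagQF k d with hQ
  set B : LinearMap.BilinForm k (ι → k) := associated (R := k) Q with hB
  have hBQ : ∀ z, B z z = Q z := fun z => associated_eq_self_apply k Q z
  have hsymm : ∀ y z, B y z = B z y := fun y z => (associated_isSymm k Q) y z
  obtain ⟨j, hj⟩ := Function.ne_iff.1 hxne
  simp only [Pi.zero_apply] at hj
  have hadd : ∀ y z, Q (y + z) = Q y + Q z + 2 * B y z := by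
    intro y z
    rw [← hBQ, ← hBQ, ← hBQ]
    simp only [map_add, LinearMap.add_apply]
    rw [hsymm z y]; ring
  have hBx : B x (Pi.single j 1) = d j * x j := by
    have h1 := hadd x (Pi.single j 1)
    simp only [hQ, diagQF_apply] at h1
    have h3 : ∑ t, d t * ((x + Pi.single j 1 : ι → k) t) ^ 2 = ∑ t, d t * (x t)^2
        + ∑ t, d t * ((Pi.single j 1 : ι → k) t)^2 + 2 * (d j * x j) := by
      have : d j * x j = ∑ t, d t * x t * (Pi.single j 1 : ι → k) t := by
        simp [Pi.single_apply]
      rw [this, Finset.mul_sum, ← Finset.sum_add_distrib, ← Finset.sum_add_distrib]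
      refine Finset.sum_congr rfl fun t _ => ?_
      simp only [Pi.add_apply]; ring
    rw [h3] at h1
    exact (mul_left_cancel₀ h2 (add_left_cancel h1)).symm
  have hQx : B x x = 0 := by rw [hBQ, hQ, diagQF_apply, hx0]
  let y : ι → k := (d j * x j)⁻¹ • Pi.single j 1
  have hxy : B x y = 1 := by
    simp only [y, map_smul, hBx, smul_eq_mul]
    exact inv_mul_cancel₀ (mul_ne_zero (hd j) hj)
  let h := y - (B y y / 2) • x
  have hxh : B x h = 1 := by simp [h, hxy, hQx]
  have hhh : B h h = 0 := by
    simp only [h, map_sub, map_smul, LinearMap.sub_apply, LinearMap.smul_apply, hQx, hsymm y x, hxy,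
      smul_eq_mul]
    field_simp; ring
  let e := (1/2 : k) • x + h
  let f := (1/2 : k) • x - h
  have hhx : B h x = 1 := by rw [hsymm, hxh]
  have hee : B e e = 1 := by
    simp only [e, map_add, map_smul, LinearMap.add_apply, LinearMap.smul_apply, hQx, hxh, hhx, hhh,
      smul_eq_mul]
    field_simp; ring
  have hff : B f f = -1 := by
    simp only [f, map_sub, map_smul, LinearMap.sub_apply, LinearMap.smul_apply, hQx, hxh, hhx, hhh,
      smul_eq_mul]
    field_simp; ring
  have hef : B e f = 0 := by
    simp only [e, f, map_sub, map_add, map_smul, LinearMap.add_apply, LinearMap.smul_apply, hQx, hxh, hhx,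
      hhh, smul_eq_mul]
    field_simp; ring
  have hfe : B f e = 0 := by rw [hsymm, hef]
  obtain ⟨s, b, hortho, hb0, hb1⟩ := hyp_basis k h2 B hsymm e f hee hff hef
  refine ⟨s, fun t => Q (b (Sum.inr t)), ?_⟩
  have h4 := basisRepr_eq_of_iIsOrtho Q b hortho
  refine ⟨(Q.isometryEquivBasisRepr b).trans ?_⟩
  rw [h4]
  have : (fun i => Q (b i)) = Sum.elim (hypForm k 1) (fun t => Q (b (Sum.inr t))) := by
    funext i
    rcases i with i | i
    · fin_cases i
      · change Q (b (Sum.inl 0)) = _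
        rw [hb0, ← hBQ, hee]; simp [hypForm]
      · change Q (b (Sum.inl 1)) = _
        rw [hb1, ← hBQ, hff]; simp [hypForm]
    · rfl
  rw [this]
  exact QuadraticMap.IsometryEquiv.refl _

lemma one_le_witt (k : Type) [Field k] (h2 : (2 : k) ≠ 0) {ι : Type} [Fintype ι] (d : ι → k)
    (hd : ∀ t, d t ≠ 0) : 1 ≤ wittIndex k d ↔ ¬ QAn k d := by
  constructor
  · intro h hq
    have : wittIndex k d ≤ 0 := by
      unfold wittIndex
      refine csSup_le' ?_
      rintro m ⟨s, e, hi⟩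
      by_contra hm
      exact hyp_not_qan k m s (by omega) e (qan_of_isom k d _ hi hq)
    omega
  · intro h
    unfold wittIndex
    refine le_csSup ⟨Fintype.card ι, ?_⟩ (isom_hyp k h2 d hd h)
    rintro m ⟨s, e, hi⟩
    have := isom_card k _ _ hi
    simp at this
    omega

end witt
section springer

lemma qan_comp (k : Type) [Field k] {ι κ : Type} [Fintype ι] [Fintype κ]
    (d : ι → k) (f : κ → ι) (hf : Function.Injective f) (hd : QAn k d) : QAn k (d ∘ f) := by
  intro x hx
  have := hd (Function.extend f x 0) (by
    rw [← hx]
    symm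
    refine Fintype.sum_of_injective f hf _ _ ?_ ?_
    · intro i hi
      rw [Function.extend_apply' _ _ _ (by simpa using hi)]
      simp
    · intro i
      simp [hf.extend_apply])
  funext t
  rw [← hf.extend_apply x 0 t, this]
  rfl

lemma res_zero_iff (K : Type) [Field K] (v : Valuation K Zm0) (x : v.valuationSubring) :
    IsLocalRing.residue v.valuationSubring x = 0 ↔ v x < 1 := by
  rw [IsLocalRing.residue_eq_zero_iff, IsLocalRing.mem_maximalIdeal, mem_nonunits_iff,
    ← not_le, not_iff_not]
  constructor
  · intro h
    obtain ⟨y, hy⟩ := h.exists_right_inv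
    have h1 : v x * v y = 1 := by
      rw [← map_mul]
      have : (x : K) * y = 1 := by exact_mod_cast congrArg Subtype.val hy
      rw [this, map_one]
    have h2 : v (y : K) ≤ 1 := y.2
    calc 1 = v x * v y := h1.symm
      _ ≤ v x := mul_le_of_le_one_right' h2
  · intro h
    have hx0 : (x : K) ≠ 0 := by
      intro h0
      rw [h0, map_zero] at h
      exact absurd h (by simp)
    refine IsUnit.of_mul_eq_one ⟨(x : K)⁻¹, ?_⟩ ?_
    · rw [Valuation.mem_valuationSubring_iff, map_inv₀]
      exact inv_le_one_of_one_le₀ h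
    · ext
      exact mul_inv_cancel₀ hx0

lemma res_ne_iff (K : Type) [Field K] (v : Valuation K Zm0) (x : v.valuationSubring) :
    IsLocalRing.residue v.valuationSubring x ≠ 0 ↔ v x = 1 := by
  rw [Ne, res_zero_iff, not_lt]
  exact ⟨fun h => le_antisymm x.2 h, fun h => h.ge⟩

lemma val_of_qan (K : Type) [Field K] (v : Valuation K Zm0) {ι : Type} [Fintype ι]
    (u : ι → v.valuationSubring)
    (h : QAn (resField K v) (fun t => IsLocalRing.residue _ (u t))) (x : ι → K) :
    ∃ c : K, v (∑ t, (u t : K) * x t ^ 2) = v c ^ 2 ∧ (c = 0 → x = 0) := by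
  by_cases hx : x = 0
  · exact ⟨0, by simp [hx], fun _ => hx⟩
  obtain ⟨j0, hj0⟩ := Function.ne_iff.1 hx
  have : Nonempty ι := ⟨j0⟩
  obtain ⟨j, hj⟩ := Finite.exists_max (fun t => v (x t))
  have hxj : x j ≠ 0 := by
    intro h0
    have := hj j0
    rw [h0, map_zero] at this
    exact hj0 (by simpa using this)
  have hvj : v (x j) ≠ 0 := v.ne_zero_iff.2 hxj
  refine ⟨x j, ?_, fun h0 => absurd h0 hxj⟩
  let y : ι → v.valuationSubring := fun t => ⟨x t / x j, by
    rw [Valuation.mem_valuationSubring_iff, map_div₀]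
    exact div_le_one_of_le₀ (hj t) zero_le⟩
  have hS : IsLocalRing.residue v.valuationSubring (∑ t, u t * y t ^ 2) ≠ 0 := by
    intro h0
    have h1 := h (fun t => IsLocalRing.residue _ (y t)) (by
      rw [← h0]; simp [map_sum, map_mul, map_pow])
    have h3 := congrFun h1 j
    have h4 : y j = 1 := by ext; exact div_self hxj
    simp [h4] at h3
  rw [res_ne_iff] at hS
  have : ∑ t, (u t : K) * x t ^ 2 = ((∑ t, u t * y t ^ 2 : v.valuationSubring) : K) * x j ^ 2 := by
    push_cast
    rw [Finset.sum_mul]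
    refine Finset.sum_congr rfl fun t _ => ?_
    simp only [y]
    field_simp
  rw [this, map_mul, hS, one_mul, map_pow]

lemma lift_iso (K : Type) [Field K] (v : Valuation K Zm0)
    (hcomp : @CompleteSpace K (Valued.mk' v).toUniformSpace)
    (h2 : v 2 = 1) {ι : Type} [Fintype ι]
    (u : ι → v.valuationSubring) (hu : ∀ t, IsLocalRing.residue _ (u t) ≠ 0)
    (h : QAn K (fun t => (u t : K))) :
    QAn (resField K v) (fun t => IsLocalRing.residue _ (u t)) := by
  classical
  intro xb hxb
  by_contra hne
  obtain ⟨j, hj⟩ := Function.ne_iff.1 hne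
  choose x hx using fun t => IsLocalRing.residue_surjective (xb t)
  have hxj : v (x j : K) = 1 := by
    rw [← res_ne_iff, hx]; exact hj
  have huj : v (u j : K) = 1 := by
    rw [← res_ne_iff]; exact hu j
  have hxj0 : (x j : K) ≠ 0 := by intro h0; simp [h0] at hxj
  have huj0 : (u j : K) ≠ 0 := by intro h0; simp [h0] at huj
  set S : K := ∑ t, (u t : K) * (x t : K) ^ 2 with hSdef
  have hS : v S < 1 := by
    have h0 : IsLocalRing.residue v.valuationSubring (∑ t, u t * x t ^ 2) = 0 := by
      rw [← hxb]; simp [map_sum, map_mul, map_pow, hx]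
    rw [res_zero_iff] at h0
    push_cast at h0
    exact h0
  let D : K := u j * (x j : K) ^ 2
  have hD : v D = 1 := by simp [D, hxj, huj]
  have hD0 : D ≠ 0 := by intro h0; simp [h0] at hD
  obtain ⟨y, hy⟩ := sqrt_one K v hcomp h2 (1 - S / D) (by
    rw [sub_sub_cancel_left, Valuation.map_neg, map_div₀, hD, div_one]; exact hS)
  have hy0 : y ≠ 0 := by
    rintro rfl
    have h3 : S = D := by
      have : S / D = 1 := by
        rw [zero_pow two_ne_zero] at hy
        exact (sub_eq_zero.1 hy.symm).symm
      field_simp at this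
      exact this
    rw [h3, hD] at hS
    exact lt_irrefl _ hS
  have h5 := h (Function.update (fun t => (x t : K)) j (x j * y)) (by
    rw [← Finset.add_sum_erase _ _ (Finset.mem_univ j)]
    rw [← Finset.add_sum_erase _ _ (Finset.mem_univ j)] at hSdef
    have h6 : ∀ t ∈ Finset.univ.erase j, (u t : K) *
        (Function.update (fun t => (x t : K)) j (x j * y) t) ^ 2 = (u t : K) * (x t : K) ^ 2 := by
      intro t ht
      rw [Function.update_of_ne (Finset.ne_of_mem_erase ht)]
    rw [Finset.sum_congr rfl h6, Function.update_self]
    have h7 : (u j : K) * (x j * y) ^ 2 = D - S := by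
      calc (u j : K) * (x j * y) ^ 2 = D * y ^ 2 := by simp only [D]; ring
        _ = D - S := by rw [hy]; field_simp
    rw [h7, hSdef]
    simp only [D]
    ring)
  have h6 := congrFun h5 j
  simp [hxj0, hy0] at h6

/-- the scaling factor -/
def pf {K : Type} [Field K] (p : K) (b : Bool) : K := if b then p else 1

lemma springer (K : Type) [Field K] (v : Valuation K Zm0)
    (hcomp : @CompleteSpace K (Valued.mk' v).toUniformSpace)
    (h2 : v 2 = 1) (p : K) (hp0 : p ≠ 0) (hp : ∀ c : K, v c ^ 2 ≠ v p) {ι : Type} [Fintype ι]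
    (u : ι → v.valuationSubring) (hu : ∀ t, IsLocalRing.residue _ (u t) ≠ 0)
    (c : ι → K) (hc : ∀ t, c t ≠ 0) (ε : ι → Bool) :
    QAn K (fun t => c t ^ 2 * pf p (ε t) * (u t : K)) ↔
      ∀ b, QAn (resField K v) (fun t : {t // ε t = b} => IsLocalRing.residue _ (u t)) := by
  constructor
  · intro h b
    refine lift_iso K v hcomp h2 (fun t : {t // ε t = b} => u t) (fun t => hu t) ?_
    intro z hz
    have h3 := h (fun t => if ht : ε t = b then z ⟨t, ht⟩ / c t else 0) (by
      rw [← Fintype.sum_fiberwise ε]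
      rw [Finset.sum_eq_single b]
      · calc _ = ∑ t : {t // ε t = b}, pf p b * ((u t : K) * z t ^ 2) := by
              refine Finset.sum_congr rfl fun t _ => ?_
              have := hc t
              beta_reduce
              rw [dif_pos t.2, t.2]
              field_simp
          _ = 0 := by rw [← Finset.mul_sum, hz, mul_zero]
      · intro b' _ hb'
        refine Finset.sum_eq_zero fun t _ => ?_
        rw [dif_neg (by rw [t.2]; exact hb')]
        simp
      · simp)
    funext t
    have h4 := congrFun h3 t
    rw [dif_pos t.2] at h4
    simpa [hc] using h4
  · intro h X hX
    obtain ⟨c0, e0, f0⟩ := val_of_qan K v _ (h false) (fun t => c t * X t)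
    obtain ⟨c1, e1, f1⟩ := val_of_qan K v _ (h true) (fun t => c t * X t)
    set S0 := ∑ t : {t // ε t = false}, (u t : K) * (c t * X t) ^ 2
    set S1 := ∑ t : {t // ε t = true}, (u t : K) * (c t * X t) ^ 2
    have hS : p * S1 + S0 = 0 := by
      rw [← hX, ← Fintype.sum_fiberwise ε, Fintype.sum_bool]
      congr 1
      · rw [Finset.mul_sum]
        refine Finset.sum_congr rfl fun t _ => ?_
        beta_reduce
        rw [t.2, pf, if_pos rfl]; ring
      · refine Finset.sum_congr rfl fun t _ => ?_
        beta_reduce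
        rw [t.2, pf, if_neg (by simp)]; ring
    have hv : v p * v c1 ^ 2 = v c0 ^ 2 := by
      rw [← e0, ← e1, ← map_mul, eq_neg_of_add_eq_zero_left hS, Valuation.map_neg]
    have hc1 : c1 = 0 := by
      by_contra hne
      apply hp (c0 / c1)
      have : v c1 ≠ 0 := v.ne_zero_iff.2 hne
      rw [map_div₀, div_pow, ← hv]
      field_simp
    have hc0 : c0 = 0 := by
      rw [hc1, map_zero] at hv
      by_contra hne
      have : v c0 ≠ 0 := v.ne_zero_iff.2 hne
      simp at hv
      exact pow_ne_zero 2 this hv.symm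
    funext t
    have : c t * X t = 0 := by
      cases ht : ε t with
      | false => exact congrFun (f0 hc0) ⟨t, ht⟩
      | true => exact congrFun (f1 hc1) ⟨t, ht⟩
    simpa [hc] using this

lemma exists_unif (K : Type) [Field K] (v : Valuation K Zm0) (hdisc : Function.Surjective v) :
    ∃ p : K, p ≠ 0 ∧ (∀ c : K, v c ^ 2 ≠ v p) ∧ ∀ d : K, d ≠ 0 →
      ∃ (c : K) (b : Bool) (u : v.valuationSubring), c ≠ 0 ∧ IsLocalRing.residue _ u ≠ 0 ∧
        d = c ^ 2 * pf p b * (u : K) := by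
  obtain ⟨p, hp⟩ := hdisc (WithZero.exp (-1 : ℤ))
  have hp0 : p ≠ 0 := by
    rintro rfl
    rw [map_zero] at hp
    exact WithZero.exp_ne_zero hp.symm
  refine ⟨p, hp0, ?_, ?_⟩
  · intro c h
    have h1 := congrArg WithZero.log h
    rw [hp, WithZero.log_pow, WithZero.log_exp] at h1
    simp at h1
    omega
  · intro d hd
    have hvd : v d ≠ 0 := v.ne_zero_iff.2 hd
    have key : ∃ (m : ℤ) (b : Bool), v (p ^ m) ^ 2 * v (pf p b) = v d := by
      obtain ⟨n, hn⟩ : ∃ n : ℤ, v d = WithZero.exp n := ⟨_, (WithZero.exp_log hvd).symm⟩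
      rcases Int.even_or_odd' (-n) with ⟨m, hm | hm⟩
      · refine ⟨m, false, ?_⟩
        rw [hn, map_zpow₀, hp, pf, if_neg (by simp), map_one, mul_one, ← WithZero.exp_zsmul,
          ← WithZero.exp_nsmul]
        congr 1
        simp; omega
      · refine ⟨m, true, ?_⟩
        rw [hn, map_zpow₀, hp, pf, if_pos rfl, hp, ← WithZero.exp_zsmul,
          ← WithZero.exp_nsmul, ← WithZero.exp_add]
        congr 1
        simp; omega
    obtain ⟨m, b, hmb⟩ := key
    have hb0 : pf p b ≠ 0 := by cases b <;> simp [pf, hp0]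
    have hm0 : p ^ m ≠ 0 := zpow_ne_zero _ hp0
    have hu1 : v (d / ((p ^ m) ^ 2 * pf p b)) = 1 := by
      rw [map_div₀, map_mul, map_pow, hmb, div_self hvd]
    refine ⟨p ^ m, b, ⟨d / ((p ^ m) ^ 2 * pf p b), hu1.le⟩, hm0, ?_, ?_⟩
    · rw [res_ne_iff]; exact hu1
    · field_simp
end springer
section combi

/-- `d` has an anisotropic extension by an `r`-dimensional form -/
def QExt (k : Type) [Field k] {ι : Type} [Fintype ι] (d : ι → k) (r : ℕ) : Prop :=
  ∃ σ : Fin r → k, (∀ t, σ t ≠ 0) ∧ QAn k (Sum.elim d σ)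

lemma qan_sum_comp (k : Type) [Field k] {α β α' β' : Type} [Fintype α] [Fintype β]
    [Fintype α'] [Fintype β'] {d : α → k} {s : β → k} {d' : α' → k} {s' : β' → k}
    (h : QAn k (Sum.elim d s)) (f : α' → α) (hf : Function.Injective f)
    (g : β' → β) (hg : Function.Injective g) (hd : ∀ t, d' t = d (f t))
    (hs : ∀ t, s' t = s (g t)) : QAn k (Sum.elim d' s') := by
  have := qan_comp k _ (Sum.map f g) (hf.sumMap hg) h
  convert this using 1
  funext t
  rcases t with t | t
  · exact hd t
  · exact hs t

lemma ext_of (k : Type) [Field k] {α β : Type} [Fintype α] [Fintype β] (d : α → k) (s : β → k)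
    (hs : ∀ t, s t ≠ 0) (h : QAn k (Sum.elim d s)) (r : ℕ) (hr : Fintype.card β = r) :
    QExt k d r := by
  let e := (Fintype.equivFinOfCardEq hr).symm
  exact ⟨s ∘ e, fun t => hs _, qan_sum_comp k h id Function.injective_id e e.injective
    (fun _ => rfl) (fun _ => rfl)⟩

lemma ext_mono (k : Type) [Field k] {α : Type} [Fintype α] (d : α → k) {r s : ℕ} (h : r ≤ s)
    (hs : QExt k d s) : QExt k d r := by
  obtain ⟨σ, h0, h1⟩ := hs
  exact ⟨σ ∘ Fin.castLE h, fun t => h0 _, qan_sum_comp k h1 id Function.injective_id _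
    (Fin.castLE_injective h) (fun _ => rfl) (fun _ => rfl)⟩

lemma ext_congr (k : Type) [Field k] {α β : Type} [Fintype α] [Fintype β] (d : α → k)
    (e : β → α) (he : Function.Injective e) {r : ℕ} (hs : QExt k d r) : QExt k (d ∘ e) r := by
  obtain ⟨σ, h0, h1⟩ := hs
  exact ⟨σ, h0, qan_sum_comp k h1 e he id Function.injective_id (fun _ => rfl) (fun _ => rfl)⟩

lemma ext_zero (k : Type) [Field k] {α : Type} [Fintype α] (d : α → k) (h : QAn k d) :
    QExt k d 0 := by
  refine ⟨Fin.elim0, fun t => t.elim0, ?_⟩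
  have := qan_comp k d (Sum.elim id Fin.elim0 : α ⊕ Fin 0 → α) (by
    rintro (a | a) (b | b) hab
    · simpa using hab
    · exact b.elim0
    · exact a.elim0
    · exact a.elim0) h
  convert this using 1
  funext t
  rcases t with t | t
  · rfl
  · exact t.elim0

lemma mInv_set (k : Type) [Field k] (h2 : (2 : k) ≠ 0) (i : ℕ) :
    mInv k i 1 = sInf {N : ℕ∞ | ∃ n : ℕ, N = n ∧ 1 ≤ n ∧
      ∃ d : Fin n → k, (∀ t, d t ≠ 0) ∧ QAn k d ∧ ¬ QExt k d i} := by
  unfold mInv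
  congr 1
  ext N
  refine exists_congr fun n => and_congr_right fun _ => and_congr_right fun _ =>
    exists_congr fun d => and_congr_right fun hd => ?_
  refine and_congr ?_ ?_
  · rw [← not_le, one_le_witt k h2 d hd, not_not]
  · unfold QExt
    push Not
    refine forall_congr' fun σ => forall_congr' fun hσ => ?_
    rw [one_le_witt k h2 _ (by rintro (t | t); exacts [hd t, hσ t])]

lemma mInv_le (k : Type) [Field k] (h2 : (2 : k) ≠ 0) (i : ℕ) {ι : Type} [Fintype ι] (d : ι → k)
    (h1 : 1 ≤ Fintype.card ι) (hd : ∀ t, d t ≠ 0) (hq : QAn k d) (hx : ¬ QExt k d i) :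
    mInv k i 1 ≤ (Fintype.card ι : ℕ∞) := by
  rw [mInv_set k h2]
  let e := (Fintype.equivFin ι)
  refine sInf_le ⟨_, rfl, h1, d ∘ e.symm, fun t => hd _, qan_comp k d _ e.symm.injective hq, ?_⟩
  intro h
  apply hx
  have := ext_congr k _ e e.injective h
  convert this using 1
  funext t
  simp

lemma mInv_att (k : Type) [Field k] (h2 : (2 : k) ≠ 0) (i : ℕ) :
    mInv k i 1 = ⊤ ∨ ∃ n : ℕ, mInv k i 1 = n ∧ 1 ≤ n ∧
      ∃ d : Fin n → k, (∀ t, d t ≠ 0) ∧ QAn k d ∧ ¬ QExt k d i := by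
  rw [mInv_set k h2]
  set S := {N : ℕ∞ | ∃ n : ℕ, N = n ∧ 1 ≤ n ∧
      ∃ d : Fin n → k, (∀ t, d t ≠ 0) ∧ QAn k d ∧ ¬ QExt k d i}
  rcases S.eq_empty_or_nonempty with h | h
  · left; rw [h, sInf_empty]
  · right; exact csInf_mem h

lemma uInv_form (k : Type) [Field k] (u : ℕ) (hu : uInv k = (u : ℕ∞)) (r : ℕ) (hr : r ≤ u)
    (hr1 : 1 ≤ r) : ∃ d : Fin r → k, (∀ t, d t ≠ 0) ∧ QAn k d := by
  have h : ((r - 1 : ℕ) : ℕ∞) < uInv k := by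
    rw [hu]; exact_mod_cast (by omega : r - 1 < u)
  unfold uInv at h
  obtain ⟨N, ⟨n, rfl, d, hd, hq⟩, hN⟩ := lt_sSup_iff.1 h
  have hN' : r - 1 < n := by exact_mod_cast hN
  have hrn : r ≤ n := by omega
  exact ⟨d ∘ Fin.castLE hrn, fun t => hd _,
    qan_comp k d _ (Fin.castLE_injective hrn) ((anis_iff k d).1 hq)⟩

lemma ext_empty (k : Type) [Field k] {α : Type} [Fintype α] (d : α → k) (h : ¬ 1 ≤ Fintype.card α)
    (r : ℕ) (hr : ∃ d : Fin r → k, (∀ t, d t ≠ 0) ∧ QAn k d) : QExt k d r := by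
  have : IsEmpty α := Fintype.card_eq_zero_iff.1 (by omega)
  obtain ⟨s, hs, hq⟩ := hr
  refine ⟨s, hs, ?_⟩
  have := qan_comp k s (Sum.elim isEmptyElim id : α ⊕ Fin r → Fin r) (by
    rintro (a | a) (b | b) hab
    · exact isEmptyElim a
    · exact isEmptyElim a
    · exact isEmptyElim b
    · simpa using hab) hq
  convert this using 1
  funext t
  rcases t with t | t
  · exact isEmptyElim t
  · rfl

/-- form built from unit parts, square factors and parities -/
def FF {K : Type} [Field K] (v : Valuation K Zm0) (p : K) {ι : Type}
    (u : ι → v.valuationSubring) (c : ι → K) (ε : ι → Bool) : ι → K :=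
  fun t => c t ^ 2 * pf p (ε t) * (u t : K)

/-- residue part of given parity -/
noncomputable def RR {K : Type} [Field K] (v : Valuation K Zm0) {ι : Type}
    (u : ι → v.valuationSubring) (ε : ι → Bool) (b : Bool) : {t // ε t = b} → resField K v :=
  fun t => IsLocalRing.residue _ (u t)

lemma springer_sum (K : Type) [Field K] (v : Valuation K Zm0)
    (hcomp : @CompleteSpace K (Valued.mk' v).toUniformSpace)
    (h2 : v 2 = 1) (p : K) (hp0 : p ≠ 0) (hp : ∀ c : K, v c ^ 2 ≠ v p)
    {ι κ : Type} [Fintype ι] [Fintype κ]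
    (u : ι → v.valuationSubring) (hu : ∀ t, IsLocalRing.residue _ (u t) ≠ 0)
    (c : ι → K) (hc : ∀ t, c t ≠ 0) (ε : ι → Bool)
    (u' : κ → v.valuationSubring) (hu' : ∀ t, IsLocalRing.residue _ (u' t) ≠ 0)
    (c' : κ → K) (hc' : ∀ t, c' t ≠ 0) (ε' : κ → Bool) :
    QAn K (Sum.elim (FF v p u c ε) (FF v p u' c' ε')) ↔
      ∀ b, QAn (resField K v) (Sum.elim (RR v u ε b) (RR v u' ε' b)) := by
  have h := springer K v hcomp h2 p hp0 hp (Sum.elim u u')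
    (by rintro (t | t); exacts [hu t, hu' t]) (Sum.elim c c')
    (by rintro (t | t); exacts [hc t, hc' t]) (Sum.elim ε ε')
  have e1 : Sum.elim (FF v p u c ε) (FF v p u' c' ε') = fun t =>
      (Sum.elim c c') t ^ 2 * pf p ((Sum.elim ε ε') t) * ((Sum.elim u u') t : K) := by
    funext t; rcases t with t | t <;> rfl
  rw [e1, h]
  refine forall_congr' fun b => ?_
  let e : {t // Sum.elim ε ε' t = b} ≃ {t // ε t = b} ⊕ {t // ε' t = b} := Equiv.subtypeSum
  constructor
  · intro hq
    convert qan_comp _ _ e.symm e.symm.injective hq using 1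
    funext t; rcases t with t | t <;> rfl
  · intro hq
    convert qan_comp _ _ e e.injective hq using 1
    funext t; rcases t with ⟨t | t, ht⟩ <;> rfl

lemma lift_split (K : Type) [Field K] (v : Valuation K Zm0) {α β : Type}
    (d1 : α → resField K v) (d2 : β → resField K v) :
    ∃ (u : α ⊕ β → v.valuationSubring) (ε : α ⊕ β → Bool)
      (e0 : α ≃ {x // ε x = false}) (e1 : β ≃ {x // ε x = true}),
      (∀ a, RR v u ε false (e0 a) = d1 a) ∧ (∀ a, RR v u ε true (e1 a) = d2 a) := by
  choose a1 h1 using fun t => IsLocalRing.residue_surjective (d1 t)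
  choose a2 h2 using fun t => IsLocalRing.residue_surjective (d2 t)
  let ε : α ⊕ β → Bool := Sum.elim (fun _ => false) (fun _ => true)
  refine ⟨Sum.elim a1 a2, ε,
    Equiv.ofBijective (fun a => ⟨Sum.inl a, rfl⟩) ⟨?_, ?_⟩,
    Equiv.ofBijective (fun a => ⟨Sum.inr a, rfl⟩) ⟨?_, ?_⟩, h1, h2⟩
  · intro a b h; exact Sum.inl_injective (congrArg Subtype.val h)
  · rintro ⟨a | a, ha⟩
    · exact ⟨a, rfl⟩
    · simp [ε] at ha
  · intro a b h; exact Sum.inr_injective (congrArg Subtype.val h)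
  · rintro ⟨a | a, ha⟩
    · simp [ε] at ha
    · exact ⟨a, rfl⟩

lemma lift_units (K : Type) [Field K] (v : Valuation K Zm0) {α β : Type}
    (d1 : α → resField K v) (d2 : β → resField K v) (hd1 : ∀ t, d1 t ≠ 0) (hd2 : ∀ t, d2 t ≠ 0)
    {ι : Type} (u : ι → v.valuationSubring) (ε : ι → Bool)
    (e0 : α ≃ {x // ε x = false}) (e1 : β ≃ {x // ε x = true})
    (h0 : ∀ a, RR v u ε false (e0 a) = d1 a) (h1 : ∀ a, RR v u ε true (e1 a) = d2 a) (t : ι) :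
    IsLocalRing.residue _ (u t) ≠ 0 := by
  cases ht : ε t with
  | false =>
    have := h0 (e0.symm ⟨t, ht⟩)
    rw [e0.apply_symm_apply] at this
    change IsLocalRing.residue _ (u t) = _ at this
    rw [this]; exact hd1 _
  | true =>
    have := h1 (e1.symm ⟨t, ht⟩)
    rw [e1.apply_symm_apply] at this
    change IsLocalRing.residue _ (u t) = _ at this
    rw [this]; exact hd2 _

lemma FF_ne (K : Type) [Field K] (v : Valuation K Zm0) (p : K) (hp0 : p ≠ 0) {ι : Type}
    (u : ι → v.valuationSubring) (hu : ∀ t, IsLocalRing.residue _ (u t) ≠ 0)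
    (c : ι → K) (hc : ∀ t, c t ≠ 0) (ε : ι → Bool) (t : ι) : FF v p u c ε t ≠ 0 := by
  have h1 : pf p (ε t) ≠ 0 := by cases ε t <;> simp [pf, hp0]
  have h3 : (u t : K) ≠ 0 := by
    intro h0
    apply hu t
    rw [res_zero_iff, h0, map_zero]
    exact zero_lt_one
  exact mul_ne_zero (mul_ne_zero (pow_ne_zero _ (hc t)) h1) h3

end combi

/-- **Proposition (refined m-invariants of a complete discretely valued field, small
`i`).**  Let `K` be a complete discretely valued field (with normalized, i.e. surjective,
discrete valuation `v`) with residue field `k` of characteristic ≠ 2 such that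
`u(k) = u < ∞`.  If `i` is any integer with `1 ≤ i ≤ u(k)`, then
`m_{i,1}(K) = min_{1 ≤ r ≤ i} (m_{r,1}(k) + m_{i-r+1,1}(k))`. -/
theorem statement18 (K : Type) [Field K] (v : Valuation K Zm0)
    (hdisc : Function.Surjective v)
    (hcomp : @CompleteSpace K (Valued.mk' v).toUniformSpace)
    (hchar : ringChar (resField K v) ≠ 2)
    (u : ℕ) (hu : uInv (resField K v) = (u : ℕ∞))
    (i : ℕ) (h1 : 1 ≤ i) (h2 : i ≤ u) :
    mInv K i 1 =
      ⨅ r ∈ Finset.Icc 1 i, (mInv (resField K v) r 1 + mInv (resField K v) (i - r + 1) 1) := by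
  classical
  have hk2 : (2 : resField K v) ≠ 0 := Ring.two_ne_zero hchar
  have hv2 : v 2 = 1 := by
    have := (res_ne_iff K v (2 : v.valuationSubring)).1 (by rw [map_ofNat]; exact hk2)
    exact_mod_cast this
  have hK2 : (2 : K) ≠ 0 := by intro h0; simp [h0] at hv2
  obtain ⟨p, hp0, hp, hdec⟩ := exists_unif K v hdisc
  apply le_antisymm
  · refine le_iInf₂ fun r hr => ?_
    rw [Finset.mem_Icc] at hr
    rcases mInv_att (resField K v) hk2 r with h | ⟨n1, e1, hn1, d1, hd1, hq1, hx1⟩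
    · rw [h]; simp
    rcases mInv_att (resField K v) hk2 (i - r + 1) with h | ⟨n2, e2, hn2, d2, hd2, hq2, hx2⟩
    · rw [h]; simp
    rw [e1, e2]
    obtain ⟨w, ε, f0, f1, g0, g1⟩ := lift_split K v d1 d2
    have hw := lift_units K v d1 d2 hd1 hd2 w ε f0 f1 g0 g1
    have hone : ∀ t : Fin n1 ⊕ Fin n2, (fun _ => 1 : Fin n1 ⊕ Fin n2 → K) t ≠ 0 :=
      fun _ => one_ne_zero
    have := mInv_le K hK2 i (FF v p w (fun _ => 1) ε) (by simp; omega)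
      (FF_ne K v p hp0 w hw _ hone ε) ?_ ?_
    · simpa using this
    · refine (springer K v hcomp hv2 p hp0 hp w hw _ hone ε).2 ?_
      intro b
      cases b with
      | false =>
        convert qan_comp _ _ f0.symm f0.symm.injective hq1 using 1
        funext t
        rw [Function.comp, ← g0, f0.apply_symm_apply]; rfl
      | true =>
        convert qan_comp _ _ f1.symm f1.symm.injective hq2 using 1
        funext t
        rw [Function.comp, ← g1, f1.apply_symm_apply]; rfl
    · rintro ⟨σ, hσ, hq⟩
      choose c' ε' w' hc' hw' hσ' using fun t => hdec (σ t) (hσ t)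
      have hσF : σ = FF v p w' c' ε' := funext hσ'
      rw [hσF] at hq
      have hb := (springer_sum K v hcomp hv2 p hp0 hp w hw _ hone ε w' hw' c' hc' ε').1 hq
      have hE1 : QExt _ d1 (Fintype.card {t // ε' t = false}) :=
        ext_of _ d1 (RR v w' ε' false) (fun t => hw' t) (qan_sum_comp _ (hb false) f0 f0.injective
          id Function.injective_id (fun t => (g0 t).symm) (fun _ => rfl)) _ rfl
      have hE2 : QExt _ d2 (Fintype.card {t // ε' t = true}) :=
        ext_of _ d2 (RR v w' ε' true) (fun t => hw' t) (qan_sum_comp _ (hb true) f1 f1.injective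
          id Function.injective_id (fun t => (g1 t).symm) (fun _ => rfl)) _ rfl
      have hcard := Fintype.sum_fiberwise ε' (fun _ => 1)
      simp only [Finset.sum_const, Finset.card_univ, smul_eq_mul, mul_one, Fintype.sum_bool,
        Fintype.card_fin] at hcard
      have l1 : Fintype.card {t // ε' t = false} < r := by
        by_contra hl
        exact hx1 (ext_mono _ _ (not_lt.1 hl) hE1)
      have l2 : Fintype.card {t // ε' t = true} < i - r + 1 := by
        by_contra hl
        exact hx2 (ext_mono _ _ (not_lt.1 hl) hE2)
      omega
  · rw [mInv_set K hK2]
    refine le_sInf ?_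
    rintro N ⟨n, rfl, hn, d, hd, hq, hx⟩
    choose c ε w hc hw hd' using fun t => hdec (d t) (hd t)
    have hdF : d = FF v p w c ε := funext hd'
    have hres := (springer K v hcomp hv2 p hp0 hp w hw c hc ε).1 (by
      rw [hdF] at hq; exact hq)
    have key : ∀ s s', s + s' = i → QExt _ (RR v w ε false) s → ¬ QExt _ (RR v w ε true) s' := by
      rintro s s' hss ⟨σ0, hσ0, hq0⟩ ⟨σ1, hσ1, hq1⟩
      apply hx
      obtain ⟨w', ε', f0, f1, g0, g1⟩ := lift_split K v σ0 σ1
      have hw' := lift_units K v σ0 σ1 hσ0 hσ1 w' ε' f0 f1 g0 g1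
      have hone : ∀ t : Fin s ⊕ Fin s', (fun _ => 1 : Fin s ⊕ Fin s' → K) t ≠ 0 :=
        fun _ => one_ne_zero
      refine ext_of K d (FF v p w' (fun _ => 1) ε') (FF_ne K v p hp0 w' hw' _ hone ε') ?_ i
        (by simp [hss])
      rw [hdF]
      refine (springer_sum K v hcomp hv2 p hp0 hp w hw c hc ε w' hw' _ hone ε').2 ?_
      intro b
      cases b with
      | false =>
        exact qan_sum_comp _ hq0 id Function.injective_id f0.symm f0.symm.injective
          (fun _ => rfl) (fun t => by rw [← g0, f0.apply_symm_apply])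
      | true =>
        exact qan_sum_comp _ hq1 id Function.injective_id f1.symm f1.symm.injective
          (fun _ => rfl) (fun t => by rw [← g1, f1.apply_symm_apply])
    have z0 : QExt _ (RR v w ε false) 0 := ext_zero _ _ (hres false)
    have z1 : QExt _ (RR v w ε true) 0 := ext_zero _ _ (hres true)
    have hex : ∃ r, ¬ QExt _ (RR v w ε false) r := ⟨i, fun h => key i 0 (by omega) h z1⟩
    let r := Nat.find hex
    have hr : ¬ QExt _ (RR v w ε false) r := Nat.find_spec hex
    have hr0 : r ≠ 0 := by
      intro h0; rw [h0] at hr; exact hr z0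
    have hri : r ≤ i := Nat.find_min' hex (fun h => key i 0 (by omega) h z1)
    have hr1 : QExt _ (RR v w ε false) (r - 1) := by
      by_contra hcon
      exact Nat.find_min hex (show r - 1 < r by omega) hcon
    have hr2 : ¬ QExt _ (RR v w ε true) (i - r + 1) := key (r - 1) _ (by omega) hr1
    have hcard := Fintype.sum_fiberwise ε (fun _ => 1)
    simp only [Finset.sum_const, Finset.card_univ, smul_eq_mul, mul_one, Fintype.sum_bool,
      Fintype.card_fin] at hcard
    refine iInf₂_le_of_le r (Finset.mem_Icc.2 ⟨by omega, hri⟩) ?_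
    have a1 := mInv_le _ hk2 r (RR v w ε false) (by
      by_contra hc0
      exact hr (ext_empty _ _ hc0 r (uInv_form _ u hu r (by omega) (by omega))))
      (fun t => hw t) (hres false) hr
    have a2 := mInv_le _ hk2 (i - r + 1) (RR v w ε true) (by
      by_contra hc0
      exact hr2 (ext_empty _ _ hc0 _ (uInv_form _ u hu _ (by omega) (by omega))))
      (fun t => hw t) (hres true) hr2
    refine (add_le_add a1 a2).trans ?_
    rw [add_comm] at hcard
    exact_mod_cast hcard.le
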